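/- Assume N > 2D, fix a vertex x ∈ X, and fix an integer 0 ≤ i ≤ D. Let γ_i(x) be the graph with vertex set {y ∈ X : dim(x ∩ y) = D − i}, where y, z are adjacent whenever dim(y ∩ z) = D−1 and x ∩ y = x ∩ z. Then γ_i(x) has exactly C(D,i)_q connected components, and these components are precisely the sets G_α = {y ∈ X : y ∩ x = α} as α ranges over the (D−i)-dimensional subspaces of x. -/

import Mathlib

/-- The `q`-integer `[m] = (q^m - 1)/(q - 1)` as a real number. -/
noncomputable def qInt (q : ℝ) (m : ℤ) : ℝ := (q ^ m - 1) / (q - 1)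

/-- The Gaussian binomial coefficient `C(l,n)_q = [l][l-1]⋯[l-n+1] / ([n][n-1]⋯[1])`
for `0 ≤ n ≤ l`, and `0` otherwise. -/
noncomputable def qBinom (q : ℝ) (l n : ℤ) : ℝ :=
  if 0 ≤ n ∧ n ≤ l then
    (∏ k ∈ Finset.range n.toNat, qInt q (l - k)) /
      (∏ k ∈ Finset.range n.toNat, qInt q (n - k))
  else 0

theorem gr_finrank_sup_span {F V : Type*} [Field F] [AddCommGroup V] [Module F V]
    [FiniteDimensional F V] (A : Submodule F V) (w : V) (hw : w ∉ A) :
    Module.finrank F ↥(A ⊔ Submodule.span F {w}) = Module.finrank F ↥A + 1 := by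
  have h := Submodule.finrank_sup_add_finrank_inf_eq A (Submodule.span F {w})
  have hw0 : w ≠ 0 := by rintro rfl; exact hw A.zero_mem
  have hd : A ⊓ Submodule.span F {w} = ⊥ := by
    rw [← disjoint_iff]
    exact ((Submodule.disjoint_span_singleton' hw0).2 hw)
  rw [hd, finrank_bot, finrank_span_singleton hw0] at h
  simpa using h

theorem gr_exists_between {F V : Type*} [Field F] [AddCommGroup V] [Module F V]
    [FiniteDimensional F V] (A B : Submodule F V) (hAB : A ≤ B) (k : ℕ)
    (hA : Module.finrank F ↥A ≤ k) (hB : k ≤ Module.finrank F ↥B) :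
    ∃ C : Submodule F V, A ≤ C ∧ C ≤ B ∧ Module.finrank F ↥C = k := by
  induction k, hA using Nat.le_induction with
  | base => exact ⟨A, le_rfl, hAB, rfl⟩
  | succ k hk ih =>
    obtain ⟨C, h1, h2, h3⟩ := ih (by omega)
    have hlt : C < B := by
      refine lt_of_le_of_ne h2 ?_
      rintro rfl
      omega
    obtain ⟨w, hwB, hwC⟩ := SetLike.exists_of_lt hlt
    refine ⟨C ⊔ Submodule.span F {w}, le_sup_of_le_left h1, ?_, ?_⟩
    · exact sup_le h2 (by simpa using hwB)
    · rw [gr_finrank_sup_span C w hwC, h3]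

theorem gr_step {F V : Type*} [Field F] [AddCommGroup V] [Module F V]
    [FiniteDimensional F V] (D : ℕ) (x y z : Submodule F V)
    (hy : Module.finrank F ↥y = D) (hz : Module.finrank F ↥z = D)
    (hxy : x ⊓ y = x ⊓ z) (hne : y ≠ z) :
    ∃ y' : Submodule F V, Module.finrank F ↥y' = D ∧ x ⊓ y = x ⊓ y' ∧ y ≠ y' ∧
      Module.finrank F ↥(y ⊓ y') = D - 1 ∧
      Module.finrank F ↥(y ⊓ z) < Module.finrank F ↥(y' ⊓ z) := by
  have hzy : ¬ z ≤ y := fun h => hne (Submodule.eq_of_le_of_finrank_eq h (by omega)).symm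
  have hyz : ¬ y ≤ z := fun h => hne (Submodule.eq_of_le_of_finrank_eq h (by omega))
  obtain ⟨w, hwz, hwy⟩ := Set.not_subset.1 hzy
  have hwS : w ∉ (y ⊓ z) ⊔ x := by
    intro h
    obtain ⟨t, ht, s, hs, hts⟩ := Submodule.mem_sup.1 h
    have hsz : s ∈ z := by
      have : s = w - t := by rw [← hts]; abel
      rw [this]; exact z.sub_mem hwz ht.2
    have hsy : s ∈ x ⊓ y := by rw [hxy]; exact ⟨hs, hsz⟩
    apply hwy
    rw [← hts]
    exact y.add_mem ht.1 hsy.2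
  obtain ⟨f, hfw, hfS⟩ := Submodule.exists_le_ker_of_notMem hwS
  have hlt : y ⊓ z < y := lt_of_le_of_ne inf_le_left (fun h => hyz (inf_eq_left.1 h))
  have hltr := Submodule.finrank_lt_finrank_of_lt hlt
  have hker : D ≤ Module.finrank F ↥(y ⊓ LinearMap.ker f) + 1 := by
    have h1 := Submodule.finrank_sup_add_finrank_inf_eq y (LinearMap.ker f)
    have h2 := LinearMap.finrank_range_add_finrank_ker f
    have h3 := Submodule.finrank_le (y ⊔ LinearMap.ker f)
    have h4 := Submodule.finrank_le (LinearMap.range f)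
    rw [Module.finrank_self] at h4
    omega
  obtain ⟨H, hH1, hH2, hH3⟩ := gr_exists_between (y ⊓ z) (y ⊓ LinearMap.ker f)
    (le_inf inf_le_left (le_sup_left.trans hfS)) (D - 1) (by omega) (by omega)
  have hHy : H ≤ y := hH2.trans inf_le_left
  have hHf : H ≤ LinearMap.ker f := hH2.trans inf_le_right
  have hwH : w ∉ H := fun h => hwy (hHy h)
  have hy'r := gr_finrank_sup_span H w hwH
  have hwy' : w ∈ H ⊔ Submodule.span F {w} :=
    le_sup_right (a := H) (Submodule.mem_span_singleton_self w)
  have hne' : y ≠ H ⊔ Submodule.span F {w} := fun h => hwy (h ▸ hwy')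
  refine ⟨H ⊔ Submodule.span F {w}, by omega, ?_, hne', ?_, ?_⟩
  · apply le_antisymm
    · refine le_inf inf_le_left ?_
      refine le_trans (le_inf inf_le_right ?_) (hH1.trans le_sup_left)
      rw [hxy]; exact inf_le_right
    · rintro v ⟨hvx, hv⟩
      refine ⟨hvx, ?_⟩
      obtain ⟨h, hh, s, hs, rfl⟩ := Submodule.mem_sup.1 hv
      obtain ⟨c, rfl⟩ := Submodule.mem_span_singleton.1 hs
      have e1 : f (h + c • w) = 0 := (le_sup_right.trans hfS) hvx
      have e2 : f h = 0 := hHf hh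
      rw [map_add, e2, map_smul, zero_add, smul_eq_mul] at e1
      have hc : c = 0 := by
        rcases mul_eq_zero.1 e1 with h | h
        · exact h
        · exact absurd h hfw
      subst hc
      simpa using hHy hh
  · have h1 : H ≤ y ⊓ (H ⊔ Submodule.span F {w}) := le_inf hHy le_sup_left
    have h2 := Submodule.finrank_mono h1
    have h3 : y ⊓ (H ⊔ Submodule.span F {w}) < y := by
      refine lt_of_le_of_ne inf_le_left (fun h => hne' ?_)
      exact Submodule.eq_of_le_of_finrank_eq (inf_eq_left.1 h) (by omega)
    have h4 := Submodule.finrank_lt_finrank_of_lt h3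
    omega
  · apply Submodule.finrank_lt_finrank_of_lt
    refine lt_of_le_of_ne (le_inf (hH1.trans le_sup_left) inf_le_right) ?_
    intro h
    have : w ∈ y ⊓ z := by rw [h]; exact ⟨hwy', hwz⟩
    exact hwy this.1

theorem gr_exists_vertex {F V : Type*} [Field F] [AddCommGroup V] [Module F V]
    [FiniteDimensional F V] (x α : Submodule F V) (h : α ≤ x) (i : ℕ)
    (hi : Module.finrank F ↥x + i ≤ Module.finrank F V) :
    ∃ y : Submodule F V, y ⊓ x = α ∧ Module.finrank F ↥y = Module.finrank F ↥α + i := by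
  obtain ⟨C, hC⟩ := Submodule.exists_isCompl x
  have hCr := Submodule.finrank_add_eq_of_isCompl hC
  obtain ⟨C', -, h1, h2⟩ := gr_exists_between ⊥ C bot_le i (by simp) (by omega)
  have hd : C' ⊓ x = ⊥ := by
    rw [← disjoint_iff]
    exact (hC.disjoint.mono_right h1).symm
  refine ⟨α ⊔ C', ?_, ?_⟩
  · rw [sup_inf_assoc_of_le C' h, hd, sup_bot_eq]
  · have := Submodule.finrank_sup_add_finrank_inf_eq α C'
    have h3 : α ⊓ C' = ⊥ := by
      rw [eq_bot_iff, ← hd]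
      exact le_inf inf_le_right (inf_le_left.trans h)
    rw [h3, finrank_bot, h2] at this
    simpa using this

theorem gr_card_mul {F V : Type*} [Field F] [Fintype F] [AddCommGroup V] [Module F V]
    [FiniteDimensional F V] (k : ℕ) (hk : k ≤ Module.finrank F V) :
    Nat.card {W : Submodule F V // Module.finrank F ↥W = k} *
      ∏ j : Fin k, (Fintype.card F ^ k - Fintype.card F ^ j.val) =
      ∏ j : Fin k, (Fintype.card F ^ Module.finrank F V - Fintype.card F ^ j.val) := by
  classical
  have hfin : Finite V := Module.finite_of_finite F
  have : Finite (Submodule F V) := inferInstance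
  letI : Fintype {W : Submodule F V // Module.finrank F ↥W = k} := Fintype.ofFinite _
  rw [← card_linearIndependent hk]
  let g : (Σ W : {W : Submodule F V // Module.finrank F ↥W = k},
      {s : Fin k → W.1 // LinearIndependent F s}) → {s : Fin k → V // LinearIndependent F s} :=
    fun p => ⟨fun j => (p.2.1 j : V), p.2.2.map' p.1.1.subtype (Submodule.ker_subtype _)⟩
  have hspan : ∀ p, p.1.1 = Submodule.span F (Set.range (g p).1) := by
    rintro ⟨⟨W, hW⟩, s, hs⟩
    symm
    apply Submodule.eq_of_le_of_finrank_eq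
    · rw [Submodule.span_le]
      rintro _ ⟨j, rfl⟩
      exact (s j).2
    · rw [finrank_span_eq_card (g ⟨⟨W, hW⟩, s, hs⟩).2]
      simpa using hW.symm
  have hbij : Function.Bijective g := by
    constructor
    · intro p p' h
      have h1 : p.1 = p'.1 := Subtype.ext (by rw [hspan p, hspan p', h])
      obtain ⟨W, s, hs⟩ := p
      obtain ⟨W', s', hs'⟩ := p'
      dsimp at h1
      subst h1
      congr 2
      funext j
      apply Subtype.ext
      exact congrFun (congrArg Subtype.val h) j
    · rintro ⟨s, hs⟩
      refine ⟨⟨⟨Submodule.span F (Set.range s), by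
        rw [finrank_span_eq_card hs]; simp⟩,
        fun j => ⟨s j, Submodule.subset_span ⟨j, rfl⟩⟩, ?_⟩, rfl⟩
      exact LinearIndependent.of_comp (Submodule.subtype _) hs
  rw [← Nat.card_congr (Equiv.ofBijective g hbij), Nat.card_sigma]
  have : ∀ W : {W : Submodule F V // Module.finrank F ↥W = k},
      Nat.card {s : Fin k → W.1 // LinearIndependent F s} =
      ∏ j : Fin k, (Fintype.card F ^ k - Fintype.card F ^ j.val) := by
    rintro ⟨W, hW⟩
    have := card_linearIndependent (K := F) (V := W) (k := k) hW.ge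
    rw [hW] at this
    exact this
  simp [this]

theorem gr_prod_aux (q : ℝ) (l n : ℕ) (h : n ≤ l) :
    (∏ k ∈ Finset.range n, (q ^ (l - k) - 1)) * ∏ j ∈ Finset.range (l - n), (q ^ (j + 1) - 1) =
      ∏ j ∈ Finset.range l, (q ^ (j + 1) - 1) := by
  induction n with
  | zero => simp
  | succ n ih =>
    rw [← ih (by omega), Finset.prod_range_succ, mul_assoc]
    congr 1
    obtain ⟨m, rfl⟩ : ∃ m, l = n + 1 + m := ⟨l - (n+1), by omega⟩
    have e1 : n + 1 + m - n = m + 1 := by omega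
    have e2 : n + 1 + m - (n + 1) = m := by omega
    rw [e1, e2, Finset.prod_range_succ, mul_comm]

theorem gr_card {F V : Type*} [Field F] [Fintype F] [AddCommGroup V] [Module F V]
    [FiniteDimensional F V] (D i : ℕ) (hD : Module.finrank F V = D) (hi : i ≤ D) :
    (Nat.card {W : Submodule F V // Module.finrank F ↥W = D - i} : ℝ) =
      qBinom (Fintype.card F : ℕ) D i := by
  have hq : (1 : ℝ) < (Fintype.card F : ℕ) := by exact_mod_cast Fintype.one_lt_card
  have hm := gr_card_mul (F := F) (V := V) (D - i) (by omega)
  rw [hD] at hm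
  have hq' : 1 ≤ Fintype.card F := Fintype.card_pos
  have key : ∀ l k : ℕ, k ≤ l →
      ((∏ j : Fin k, (Fintype.card F ^ l - Fintype.card F ^ j.val) : ℕ) : ℝ) =
      (∏ j ∈ Finset.range k, (Fintype.card F : ℝ) ^ j) *
        ∏ j ∈ Finset.range k, ((Fintype.card F : ℝ) ^ (l - j) - 1) := by
    intro l k hk
    rw [Fin.prod_univ_eq_prod_range (fun j => Fintype.card F ^ l - Fintype.card F ^ j) k,
      ← Finset.prod_mul_distrib, Nat.cast_prod]
    refine Finset.prod_congr rfl fun j hj => ?_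
    have hj' := Finset.mem_range.1 hj
    rw [Nat.cast_sub (Nat.pow_le_pow_right hq' (by omega)), mul_sub, mul_one, ← pow_add]
    push_cast
    congr 2
    omega
  have hm' := congrArg (Nat.cast : ℕ → ℝ) hm
  rw [Nat.cast_mul, key _ _ le_rfl, key _ _ (Nat.sub_le D i)] at hm'
  generalize (Nat.card {W : Submodule F V // Module.finrank F ↥W = D - i} : ℝ) = c at *
  have hqb : qBinom (Fintype.card F : ℕ) D i =
      (∏ k ∈ Finset.range i, ((Fintype.card F : ℝ) ^ (D - k) - 1)) /
      (∏ k ∈ Finset.range i, ((Fintype.card F : ℝ) ^ (i - k) - 1)) := by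
    unfold qBinom qInt
    rw [if_pos (by omega), ← Finset.prod_div_distrib, ← Finset.prod_div_distrib, Int.toNat_natCast]
    refine Finset.prod_congr rfl fun j hj => ?_
    have hj' := Finset.mem_range.1 hj
    rw [div_div_div_cancel_right₀ (by linarith)]
    rw [← Nat.cast_sub (by omega : j ≤ D), ← Nat.cast_sub (by omega : j ≤ i), zpow_natCast,
      zpow_natCast]
  rw [hqb]
  generalize (Fintype.card F : ℝ) = Q at *
  have hpos : ∀ m : ℕ, (∏ j ∈ Finset.range m, (Q ^ (j + 1) - 1)) ≠ 0 := fun m =>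
    Finset.prod_ne_zero_iff.2 fun j _ =>
      ne_of_gt (sub_pos.2 (one_lt_pow₀ hq (Nat.succ_ne_zero j)))
  have hpow : (∏ j ∈ Finset.range (D - i), Q ^ j) ≠ 0 :=
    Finset.prod_ne_zero_iff.2 fun j _ => pow_ne_zero _ (by linarith)
  have a1 := gr_prod_aux Q D i hi
  have a2 := gr_prod_aux Q i i le_rfl
  have a3 := gr_prod_aux Q D (D - i) (Nat.sub_le _ _)
  have a4 := gr_prod_aux Q (D - i) (D - i) le_rfl
  rw [Nat.sub_self, Finset.prod_range_zero, mul_one] at a2 a4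
  rw [Nat.sub_sub_self hi] at a3
  rw [a2, eq_div_iff (hpos i)]
  rw [a4, mul_left_comm] at hm'
  have hm2 := mul_left_cancel₀ hpow hm'
  apply mul_right_cancel₀ (hpos (D - i))
  rw [a1, ← a3, ← hm2]
  ring

/-- Assume `N > 2D`, fix a vertex `x` of the Grassmann graph `J_q(N,D)`, and fix `0 ≤ i ≤ D`.
Let `γ_i(x)` be the graph on `{y : dim(x ∩ y) = D - i}` where `y,z` are adjacent whenever
`dim(y ∩ z) = D - 1` and `x ∩ y = x ∩ z`. Then `γ_i(x)` has exactly `C(D,i)_q` connected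
components, and these components are precisely the sets `G_α = {y : y ∩ x = α}` as `α` ranges
over the `(D-i)`-dimensional subspaces of `x`. -/
theorem stmt6 (q : ℕ) (F : Type*) [Field F] [Fintype F] (hF : Fintype.card F = q)
    (N D : ℕ) (hD : 1 ≤ D) (hND : 2 * D < N)
    (V : Type*) [AddCommGroup V] [Module F V] [FiniteDimensional F V]
    (hV : Module.finrank F V = N)
    (x : {W : Submodule F V // Module.finrank F ↥W = D})
    (i : ℕ) (hi : i ≤ D)
    (γ : SimpleGraph {y : {W : Submodule F V // Module.finrank F ↥W = D} //
          Module.finrank F ↥(x.1 ⊓ y.1) = D - i})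
    (hγ : γ = SimpleGraph.fromRel
        (fun y z : {y : {W : Submodule F V // Module.finrank F ↥W = D} //
              Module.finrank F ↥(x.1 ⊓ y.1) = D - i} =>
          Module.finrank F ↥(y.1.1 ⊓ z.1.1) = D - 1 ∧ x.1 ⊓ y.1.1 = x.1 ⊓ z.1.1)) :
    (Nat.card γ.ConnectedComponent : ℝ) = qBinom q D i ∧
    (∀ c : γ.ConnectedComponent, ∃ α : Submodule F V, α ≤ x.1 ∧
        Module.finrank F ↥α = D - i ∧
        {y | γ.connectedComponentMk y = c} = {y | y.1.1 ⊓ x.1 = α}) ∧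
    (∀ α : Submodule F V, α ≤ x.1 → Module.finrank F ↥α = D - i →
        ∃ c : γ.ConnectedComponent,
          {y | γ.connectedComponentMk y = c} = {y | y.1.1 ⊓ x.1 = α}) := by
  subst hF
  subst hV
  have hadj : ∀ y z, γ.Adj y z ↔ y ≠ z ∧ Module.finrank F ↥(y.1.1 ⊓ z.1.1) = D - 1 ∧
      x.1 ⊓ y.1.1 = x.1 ⊓ z.1.1 := by
    intro y z
    rw [hγ, SimpleGraph.fromRel_adj]
    constructor
    · rintro ⟨h, h' | ⟨h1, h2⟩⟩
      · exact ⟨h, h'⟩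
      · exact ⟨h, by rw [inf_comm]; exact h1, h2.symm⟩
    · rintro ⟨h, h'⟩
      exact ⟨h, Or.inl h'⟩
  have hreach1 : ∀ y z, γ.Reachable y z → x.1 ⊓ y.1.1 = x.1 ⊓ z.1.1 := by
    rintro y z ⟨p⟩
    induction p with
    | nil => rfl
    | cons h _ ih => exact ((hadj _ _).1 h).2.2.trans ih
  have hreach2 : ∀ (n : ℕ) (y z : {y : {W : Submodule F V // Module.finrank F ↥W = D} //
      Module.finrank F ↥(x.1 ⊓ y.1) = D - i}), x.1 ⊓ y.1.1 = x.1 ⊓ z.1.1 →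
      D - Module.finrank F ↥(y.1.1 ⊓ z.1.1) ≤ n → γ.Reachable y z := by
    intro n
    induction n with
    | zero =>
      intro y z _ h
      have e1 : y.1.1 ⊓ z.1.1 = y.1.1 :=
        Submodule.eq_of_le_of_finrank_le inf_le_left (by rw [y.1.2]; omega)
      have e2 : y.1.1 = z.1.1 :=
        Submodule.eq_of_le_of_finrank_eq (inf_eq_left.1 e1) (by rw [y.1.2, z.1.2])
      have : y = z := Subtype.ext (Subtype.ext e2)
      rw [this]
    | succ n ih =>
      intro y z h hn
      by_cases hyz : y.1.1 = z.1.1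
      · have : y = z := Subtype.ext (Subtype.ext hyz)
        rw [this]
      · obtain ⟨y', h1, h2, h3, h4, h5⟩ := gr_step D x.1 y.1.1 z.1.1 y.1.2 z.1.2 h hyz
        let Y : {y : {W : Submodule F V // Module.finrank F ↥W = D} //
          Module.finrank F ↥(x.1 ⊓ y.1) = D - i} := ⟨⟨y', h1⟩, by rw [← h2]; exact y.2⟩
        have hY : γ.Adj y Y := (hadj _ _).2
          ⟨fun e => h3 (congrArg (fun t => t.1.1) e), h4, h2⟩
        refine hY.reachable.trans (ih Y z (h2.symm.trans h) ?_)
        change D - Module.finrank F ↥(y' ⊓ z.1.1) ≤ n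
        omega
  have hmk : ∀ y z, γ.connectedComponentMk y = γ.connectedComponentMk z ↔
      x.1 ⊓ y.1.1 = x.1 ⊓ z.1.1 := by
    intro y z
    rw [SimpleGraph.ConnectedComponent.eq]
    exact ⟨hreach1 y z, fun h => hreach2 _ y z h le_rfl⟩
  have hex : ∀ α : Submodule F V, α ≤ x.1 → Module.finrank F ↥α = D - i →
      ∃ y : {y : {W : Submodule F V // Module.finrank F ↥W = D} //
          Module.finrank F ↥(x.1 ⊓ y.1) = D - i}, x.1 ⊓ y.1.1 = α := by
    intro α h1 h2
    obtain ⟨y, hy1, hy2⟩ := gr_exists_vertex x.1 α h1 i (by rw [x.2]; omega)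
    rw [inf_comm] at hy1
    exact ⟨⟨⟨y, by omega⟩, by rw [← h2, hy1]⟩, hy1⟩
  refine ⟨?_, ?_, ?_⟩
  · rw [← gr_card (F := F) (V := x.1) D i x.2 hi]
    congr 1
    symm
    have hb : ∀ β : {W : Submodule F x.1 // Module.finrank F ↥W = D - i},
        Module.finrank F ↥(β.1.map x.1.subtype) = D - i := fun β => by
      rw [Submodule.finrank_map_subtype_eq]; exact β.2
    choose g hg using fun β : {W : Submodule F x.1 // Module.finrank F ↥W = D - i} =>
      hex (β.1.map x.1.subtype) (Submodule.map_subtype_le _ _) (hb β)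
    refine Nat.card_congr (Equiv.ofBijective (fun β => γ.connectedComponentMk (g β)) ⟨?_, ?_⟩)
    · intro β β' h
      have h' := (hmk _ _).1 h
      rw [hg, hg] at h'
      exact Subtype.ext (Submodule.map_injective_of_injective x.1.injective_subtype h')
    · intro c
      induction c using SimpleGraph.ConnectedComponent.ind with
      | h y =>
        have e : ((x.1 ⊓ y.1.1).comap x.1.subtype).map x.1.subtype = x.1 ⊓ y.1.1 := by
          rw [Submodule.map_comap_subtype, ← inf_assoc, inf_idem]
        refine ⟨⟨(x.1 ⊓ y.1.1).comap x.1.subtype, ?_⟩, ?_⟩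
        · rw [← Submodule.finrank_map_subtype_eq, e]; exact y.2
        · apply (hmk _ _).2
          rw [hg, e]
  · intro c
    induction c using SimpleGraph.ConnectedComponent.ind with
    | h y =>
      refine ⟨x.1 ⊓ y.1.1, inf_le_left, y.2, ?_⟩
      ext z
      simp only [Set.mem_setOf_eq]
      rw [hmk, inf_comm z.1.1]
  · intro α h1 h2
    obtain ⟨y, rfl⟩ := hex α h1 h2
    refine ⟨γ.connectedComponentMk y, ?_⟩
    ext z
    simp only [Set.mem_setOf_eq]
    rw [hmk, inf_comm z.1.1]
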